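/- arXiv:1509.04535 — 2 statements merged into one kernel-verified Lean document; each statement's English description precedes it below -/
import Mathlib

section
/- Let (K,v) be a valued field of characteristic p > 0. If every element of the maximal ideal M_v is of the form x^p - x for some x in K, then (K,v) is p-henselian. -/
/-- A valued field `(K, v)` is `p`-henselian if `v` extends uniquely to every
Galois extension of `K` of degree `p`. -/
def IsPHenselian (p : ℕ) (K : Type) [Field K] {Γ : Type}
    [LinearOrderedCommGroupWithZero Γ] (v : Valuation K Γ) : Prop :=
  ∀ (L : Type) [Field L] [Algebra K L], FiniteDimensional K L → IsGalois K L →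
    Module.finrank K L = p →
    ∃! O : ValuationSubring L, O.comap (algebraMap K L) = v.valuationSubring

section Aux

open Filter

variable {L : Type*} [Field L] {Γ : Type*} [LinearOrderedCommGroupWithZero Γ]

lemma aux_pow_sub_one (w : Valuation L Γ) (z : L) (hz : w (z - 1) < 1) (k : ℕ) :
    w (z ^ k - 1) < 1 := by
  have hz1 : w z ≤ 1 := by
    have : z = (z - 1) + 1 := by ring
    rw [this]
    exact w.map_add_le hz.le (by simp)
  induction k with
  | zero => simp
  | succ k ih =>
    have : z ^ (k + 1) - 1 = z * (z ^ k - 1) + (z - 1) := by ring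
    rw [this]
    refine w.map_add_lt ?_ hz
    rw [map_mul]
    exact mul_lt_one_of_nonneg_of_lt_one_right hz1 zero_le ih

lemma aux_unit (w : Valuation L Γ) (y : L) (hy : w y = 1) :
    ∀ᶠ N : ℕ in atTop, w (1 + y ^ N.factorial * (y - 1)) = 1 := by
  have hy1 : w (y - 1) ≤ 1 := w.map_sub_le hy.le (by simp)
  by_cases h : ∃ d : ℕ, 0 < d ∧ w (y ^ d - 1) < 1
  · obtain ⟨d, hd, hdy⟩ := h
    filter_upwards [eventually_ge_atTop d] with N hN
    obtain ⟨k, hk⟩ := Nat.dvd_factorial hd hN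
    have h1 := aux_pow_sub_one w (y ^ d) hdy k
    rw [← pow_mul, ← hk] at h1
    have : 1 + y ^ N.factorial * (y - 1) = y + (y ^ N.factorial - 1) * (y - 1) := by ring
    rw [this, w.map_add_eq_of_lt_left, hy]
    rw [hy, map_mul]
    exact mul_lt_one_of_nonneg_of_lt_one_left zero_le h1 hy1
  · push Not at h
    have hle : ∀ n : ℕ, w (1 + y ^ n * (y - 1)) ≤ 1 := by
      intro n
      refine w.map_add_le (by simp) ?_
      rw [map_mul, map_pow, hy, one_pow, one_mul]
      exact hy1
    by_cases hb : ∃ N0 : ℕ, w (1 + y ^ N0.factorial * (y - 1)) < 1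
    · obtain ⟨N0, hN0⟩ := hb
      filter_upwards [eventually_ge_atTop (N0 + 2)] with N hN
      refine le_antisymm (hle _) ?_
      by_contra hlt
      push Not at hlt
      have hfac : N0.factorial < N.factorial :=
        lt_of_le_of_lt (Nat.factorial_le (Nat.le_succ N0))
          ((Nat.factorial_lt (Nat.succ_pos N0)).2 (by omega))
      obtain ⟨e, he⟩ := Nat.exists_eq_add_of_lt hfac
      have h2 := w.map_sub_lt hlt hN0
      have h3 : (1 + y ^ N.factorial * (y - 1)) - (1 + y ^ N0.factorial * (y - 1))
          = y ^ N0.factorial * ((y - 1) * (y ^ (e + 1) - 1)) := by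
        rw [he]; ring
      rw [h3, map_mul, map_pow, hy, one_pow, one_mul, map_mul] at h2
      have h4 := h 1 one_pos
      rw [pow_one] at h4
      have h5 := h (e + 1) (Nat.succ_pos e)
      exact absurd h2 (not_lt.2 (one_le_mul h4 h5))
    · push Not at hb
      exact Eventually.of_forall fun N => le_antisymm (hle _) (hb N)

/-- the effect of `y ↦ y / (1 + y ^ n * (y - 1))` for one valuation -/
lemma aux_bounded (w : Valuation L Γ) (y : L) :
    ∀ᶠ N : ℕ in atTop, w (y / (1 + y ^ N.factorial * (y - 1))) ≤ 1 ∧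
      (w y < 1 → w (y / (1 + y ^ N.factorial * (y - 1))) < 1) := by
  rcases lt_trichotomy (w y) 1 with h | h | h
  · refine Eventually.of_forall fun N => ?_
    have h1 : w (y ^ N.factorial * (y - 1)) < 1 := by
      rw [map_mul, map_pow]
      refine mul_lt_one_of_nonneg_of_lt_one_left zero_le ?_ (w.map_sub_le h.le (by simp))
      exact pow_lt_one₀ zero_le h (Nat.factorial_ne_zero N)
    rw [map_div₀, w.map_one_add_of_lt h1, div_one]
    exact ⟨h.le, fun _ => h⟩
  · filter_upwards [aux_unit w y h] with N hN
    rw [map_div₀, hN, h, div_one]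
    exact ⟨le_rfl, fun h => absurd h (lt_irrefl _)⟩
  · refine Eventually.of_forall fun N => ⟨?_, fun h' => absurd h' (not_lt.2 h.le)⟩
    have h0 : w (y - 1) = w y := w.map_sub_eq_of_lt_left (by simpa using h)
    have h1 : 1 ≤ w y ^ N.factorial := one_le_pow₀ h.le
    have h2 : w y ≤ w (y ^ N.factorial * (y - 1)) := by
      rw [map_mul, map_pow, h0]
      exact le_mul_of_one_le_left zero_le h1
    have h3 : w (1 + y ^ N.factorial * (y - 1)) = w (y ^ N.factorial * (y - 1)) :=
      w.map_add_eq_of_lt_right (by simpa using lt_of_lt_of_le h h2)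
    rw [map_div₀, h3]
    exact div_le_one_of_le₀ h2 zero_le

lemma aux_near_one (w : Valuation L Γ) (y : L) (hy : w (y - 1) < 1) (n : ℕ) :
    w (y / (1 + y ^ n * (y - 1)) - 1) < 1 := by
  have hy1 : w y ≤ 1 := by
    have : y = (y - 1) + 1 := by ring
    rw [this]
    exact w.map_add_le hy.le (by simp)
  have h1 : w (y ^ n * (y - 1)) < 1 := by
    rw [map_mul, map_pow]
    exact mul_lt_one_of_nonneg_of_lt_one_right (pow_le_one₀ zero_le hy1) zero_le hy
  have h2 := w.map_one_add_of_lt h1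
  have h3 : 1 + y ^ n * (y - 1) ≠ 0 := by
    intro h
    rw [h, map_zero] at h2
    exact zero_ne_one h2
  rw [div_sub_one h3, map_div₀, h2, div_one]
  have : y - (1 + y ^ n * (y - 1)) = (y - 1) - y ^ n * (y - 1) := by ring
  rw [this]
  exact w.map_sub_lt hy h1

lemma aux_approx {ι : Type*} (S : Finset ι) (w0 : Valuation L Γ) (w : ι → Valuation L Γ)
    (h : ∀ i ∈ S, ∃ x, 1 < w0 x ∧ w i x < 1) :
    ∃ θ : L, w0 (θ - 1) < 1 ∧ ∀ i ∈ S, w i θ < 1 := by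
  have h1 : ∀ i ∈ S, ∃ z : L, w0 (z - 1) < 1 ∧ w i z < 1 ∧ ∀ j ∈ S, w j z ≤ 1 := by
    intro i hi
    obtain ⟨x, hx0, hxi⟩ := h i hi
    have e0 : w0 (1 + x) = w0 x := w0.map_add_eq_of_lt_right (by simpa using hx0)
    have ei : w i (1 + x) = 1 := (w i).map_one_add_of_lt hxi
    have hne : 1 + x ≠ 0 := by
      intro h
      rw [h, map_zero] at ei
      exact zero_ne_one ei
    obtain ⟨N, hN⟩ := ((Filter.eventually_all_finset S).2
      (fun j _ => aux_bounded (w j) (x / (1 + x)))).exists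
    refine ⟨_, aux_near_one w0 (x / (1 + x)) ?_ N.factorial, (hN i hi).2 ?_,
      fun j hj => (hN j hj).1⟩
    · have : x / (1 + x) - 1 = - (1 / (1 + x)) := by field_simp; ring
      rw [this, Valuation.map_neg, map_div₀, e0, map_one, one_div]
      exact inv_lt_one_of_one_lt₀ hx0
    · rw [map_div₀, ei, div_one]
      exact hxi
  choose! z hz0 hzi hzj using h1
  refine ⟨∏ i ∈ S, z i, ?_, ?_⟩
  · clear hzi hzj h
    classical
    induction S using Finset.induction_on with
    | empty => simp
    | insert a s ha ih =>
      rw [Finset.prod_insert ha]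
      have i1 := ih (fun i hi => hz0 i (Finset.mem_insert_of_mem hi))
      have i2 := hz0 a (Finset.mem_insert_self a s)
      have i3 : w0 (z a) ≤ 1 := by
        have : z a = (z a - 1) + 1 := by ring
        rw [this]
        exact w0.map_add_le i2.le (by simp)
      have : z a * ∏ i ∈ s, z i - 1 = z a * (∏ i ∈ s, z i - 1) + (z a - 1) := by ring
      rw [this]
      refine w0.map_add_lt ?_ i2
      rw [map_mul]
      exact mul_lt_one_of_nonneg_of_lt_one_right i3 zero_le i1
  · intro i hi
    classical
    rw [← Finset.mul_prod_erase S z hi, map_mul, map_prod]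
    refine mul_lt_one_of_nonneg_of_lt_one_left zero_le (hzi i hi) ?_
    exact Finset.prod_le_one' fun j hj => hzj j (Finset.mem_of_mem_erase hj) i hi

end Aux

section Main

variable {p : ℕ} {K L : Type*} [Field K] [Field L] [Algebra K L]
  {Γ : Type*} [LinearOrderedCommGroupWithZero Γ]

lemma aux_lt_one (v : Valuation K Γ) (O : ValuationSubring L)
    (hO : O.comap (algebraMap K L) = v.valuationSubring) (b : K)
    (hb : O.valuation (algebraMap K L b) < 1) : v b < 1 := by
  by_contra h
  push Not at h
  have hb0 : b ≠ 0 := by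
    rintro rfl
    simp at h
  have h1 : b⁻¹ ∈ v.valuationSubring := by
    rw [Valuation.mem_valuationSubring_iff, map_inv₀]
    exact inv_le_one_of_one_le₀ h
  rw [← hO, ValuationSubring.mem_comap, ← O.valuation_le_one_iff, map_inv₀, map_inv₀] at h1
  have h2 : O.valuation (algebraMap K L b) ≠ 0 := by simpa using hb0
  exact absurd h1 (not_le.2 ((one_lt_inv₀ (zero_lt_iff.2 h2)).2 hb))

lemma aux_stable (hp : p.Prime) [CharP K p] (v : Valuation K Γ)
    (hM : ∀ b : K, v b < 1 → ∃ x : K, x ^ p - x = b)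
    [FiniteDimensional K L] [IsGalois K L] (hfin : Module.finrank K L = p)
    (O : ValuationSubring L) (hO : O.comap (algebraMap K L) = v.valuationSubring) :
    ∀ g : L ≃ₐ[K] L, ∀ x ∈ O, g x ∈ O := by
  have : Fact p.Prime := ⟨hp⟩
  have : CharP L p := charP_of_injective_algebraMap (algebraMap K L).injective p
  have hcard : Nat.card (L ≃ₐ[K] L) = p := by rw [IsGalois.card_aut_eq_finrank, hfin]
  by_contra hns
  have key : ∀ τ : L ≃ₐ[K] L, τ ≠ 1 → ∃ t ∈ O, τ t ∉ O := by
    intro τ hτ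
    by_contra hcon
    push Not at hcon
    apply hns
    intro g
    obtain ⟨k, rfl⟩ := mem_powers_of_prime_card (g' := g) hcard hτ
    clear hns
    intro x hx
    show (τ ^ k) x ∈ O
    induction k with
    | zero => simpa using hx
    | succ k ih =>
      rw [pow_succ', AlgEquiv.mul_apply]
      exact hcon _ ih
  have hsep : ∀ τ : L ≃ₐ[K] L, τ ≠ 1 →
      ∃ x, 1 < O.valuation x ∧ O.valuation (τ x) < 1 := by
    intro τ hτ
    obtain ⟨s, hs, hs'⟩ := key τ hτ
    obtain ⟨t, ht, ht'⟩ := key τ⁻¹ (inv_ne_one.2 hτ)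
    have hτt : τ (τ⁻¹ t) = t := by
      rw [← AlgEquiv.mul_apply, mul_inv_cancel]; rfl
    rw [← O.valuation_le_one_iff] at hs hs' ht ht'
    push Not at hs' ht'
    have hs0 : s ≠ 0 := by
      rintro rfl
      simp at hs'
    have p1 : 0 < O.valuation s := zero_lt_iff.2 (by simpa using hs0)
    have p2 : 0 < O.valuation (τ s) := zero_lt_iff.2 (by simpa using hs0)
    refine ⟨τ⁻¹ t / s, ?_, ?_⟩
    · rw [map_div₀, one_lt_div₀ p1]
      exact lt_of_le_of_lt hs ht'
    · rw [map_div₀, map_div₀, hτt, div_lt_one₀ p2]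
      exact lt_of_le_of_lt ht hs'
  have : Nontrivial (L ≃ₐ[K] L) := by
    rw [← Finite.one_lt_card_iff_nontrivial, hcard]
    exact hp.one_lt
  obtain ⟨σ, hσ⟩ := exists_ne (1 : L ≃ₐ[K] L)
  have hord : orderOf σ = p := by
    have := orderOf_dvd_natCard σ
    rw [hcard] at this
    rcases (Nat.dvd_prime hp).1 this with h | h
    · exact absurd (orderOf_eq_one_iff.1 h) hσ
    · exact h
  have hσp : σ ^ p = 1 := by rw [← hord]; exact pow_orderOf_eq_one σ
  obtain ⟨θ, hθ0, hθ⟩ := aux_approx (Finset.Ico 1 p) O.valuation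
    (fun i => O.valuation.comap ((σ ^ i : L ≃ₐ[K] L) : L →+* L)) (by
      intro i hi
      rw [Finset.mem_Ico] at hi
      exact hsep (σ ^ i) (pow_ne_one_of_lt_orderOf (by omega) (by omega)))
  have hθ' : ∀ i, 1 ≤ i → i < p → O.valuation ((σ ^ i) θ) < 1 := by
    intro i h1 h2
    exact hθ i (Finset.mem_Ico.2 ⟨h1, h2⟩)
  have hstep : ∀ i, σ ((σ ^ i) θ) = (σ ^ (i + 1)) θ := by
    intro i
    rw [pow_succ', AlgEquiv.mul_apply]
  have hT : ∑ i ∈ Finset.range p, (σ ^ (i + 1)) θ = ∑ i ∈ Finset.range p, (σ ^ i) θ := by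
    have h1 := Finset.sum_range_succ (fun i => (σ ^ i) θ) p
    rw [Finset.sum_range_succ', hσp, pow_zero] at h1
    exact add_right_cancel h1
  obtain ⟨q, rfl⟩ : ∃ q, p = q + 1 := ⟨p - 1, by have := hp.pos; omega⟩
  set T := ∑ i ∈ Finset.range (q + 1), (σ ^ i) θ with hTdef
  set c := ∑ i ∈ Finset.range (q + 1), (i : L) * (σ ^ i) θ with hcdef
  have hσT : σ T = T := by
    refine Eq.trans ?_ hT
    rw [hTdef, map_sum]
    exact Finset.sum_congr rfl fun i _ => hstep i
  have hσc : σ c = c - T := by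
    have h1 : σ c = ∑ i ∈ Finset.range (q + 1), (i : L) * (σ ^ (i + 1)) θ := by
      rw [hcdef, map_sum]
      exact Finset.sum_congr rfl fun i _ => by rw [map_mul, map_natCast, hstep]
    have h2 : ∑ i ∈ Finset.range (q + 1), ((i + 1 : ℕ) : L) * (σ ^ (i + 1)) θ = c := by
      have h3 := Finset.sum_range_succ (fun i => (i : L) * (σ ^ i) θ) (q + 1)
      rw [Finset.sum_range_succ', CharP.cast_eq_zero L (q + 1)] at h3
      simpa [hcdef] using h3
    rw [h1, eq_sub_iff_add_eq, ← hT, ← Finset.sum_add_distrib, ← h2]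
    exact Finset.sum_congr rfl fun i _ => by push_cast; ring
  have hwnat : ∀ n : ℕ, O.valuation (n : L) ≤ 1 := fun n =>
    (O.valuation_le_one_iff _).2 (natCast_mem O n)
  have hwc : O.valuation c < 1 := by
    rw [hcdef]
    refine O.valuation.map_sum_lt one_ne_zero ?_
    intro i hi
    rcases Nat.eq_zero_or_pos i with rfl | hi0
    · simp
    · rw [map_mul]
      exact mul_lt_one_of_nonneg_of_lt_one_right (hwnat i) zero_le
        (hθ' i hi0 (Finset.mem_range.1 hi))
  have hwT : O.valuation T = 1 := by
    have h1 : T = 1 + ((θ - 1) + ∑ i ∈ Finset.range q, (σ ^ (i + 1)) θ) := by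
      rw [hTdef, Finset.sum_range_succ', pow_zero, AlgEquiv.one_apply]
      ring
    rw [h1]
    refine O.valuation.map_one_add_of_lt (O.valuation.map_add_lt hθ0 ?_)
    refine O.valuation.map_sum_lt one_ne_zero fun i hi => ?_
    rw [Finset.mem_range] at hi
    exact hθ' (i + 1) (by omega) (by omega)
  have hT0 : T ≠ 0 := by
    intro h
    rw [h, map_zero] at hwT
    exact zero_ne_one hwT
  set a := c / T with hadef
  have hwa : O.valuation a < 1 := by rw [hadef, map_div₀, hwT, div_one]; exact hwc
  have hσa : σ a = a - 1 := by
    rw [hadef, map_div₀, hσT, hσc, sub_div, div_self hT0]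
  have hfix : σ (a ^ (q + 1) - a) = a ^ (q + 1) - a := by
    rw [map_sub, map_pow, hσa, sub_pow_char, one_pow]
    ring
  have hfixall : ∀ g : L ≃ₐ[K] L, g (a ^ (q + 1) - a) = a ^ (q + 1) - a := by
    intro g
    obtain ⟨k, rfl⟩ := mem_powers_of_prime_card (g' := g) hcard hσ
    show (σ ^ k) _ = _
    induction k with
    | zero => simp
    | succ k ih => rw [pow_succ, AlgEquiv.mul_apply, hfix, ih]
  obtain ⟨b, hb⟩ := (IsGalois.mem_range_algebraMap_iff_fixed (F := K) _).2 hfixall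
  have hvb : v b < 1 := by
    apply aux_lt_one v O hO
    rw [hb]
    refine O.valuation.map_sub_lt ?_ hwa
    rw [map_pow]
    exact pow_lt_one₀ zero_le hwa (Nat.succ_ne_zero q)
  obtain ⟨x, hx⟩ := hM b hvb
  have hd : (a - algebraMap K L x) ^ (q + 1) = a - algebraMap K L x := by
    have h1 := congrArg (algebraMap K L) hx
    rw [hb, map_sub, map_pow] at h1
    rw [sub_pow_char]
    linear_combination -h1
  have hd2 := (Subfield.mem_bot_iff_pow_eq_self L (q + 1)).2 hd
  have hd3 : a - algebraMap K L x ∈ (algebraMap K L).fieldRange :=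
    (bot_le : (⊥ : Subfield L) ≤ _) hd2
  obtain ⟨y, hy⟩ := hd3
  have h1 : σ (a - algebraMap K L x) = a - algebraMap K L x := by
    rw [← hy]; exact σ.commutes y
  rw [map_sub, σ.commutes, hσa] at h1
  exact one_ne_zero (α := L) (by linear_combination -h1)

lemma aux_le (v : Valuation K Γ) [FiniteDimensional K L] [IsGalois K L]
    (O O' : ValuationSubring L) (hO : O.comap (algebraMap K L) = v.valuationSubring)
    (hO' : O'.comap (algebraMap K L) = v.valuationSubring)
    (hst : ∀ g : L ≃ₐ[K] L, ∀ x ∈ O, g x ∈ O) : O ≤ O' := by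
  intro x hx
  classical
  haveI : Fintype (L ≃ₐ[K] L) := Fintype.ofFinite _
  have hlift : MulSemiringAction.charpoly (L ≃ₐ[K] L) x ∈ Polynomial.lifts O.subtype := by
    rw [MulSemiringAction.charpoly_eq]
    refine prod_mem fun g _ => ?_
    refine ⟨Polynomial.X - Polynomial.C (⟨g x, hst g x hx⟩ : O), ?_⟩
    simp
  have hlift' : MulSemiringAction.charpoly (L ≃ₐ[K] L) x ∈ Polynomial.lifts O'.subtype := by
    rw [Polynomial.lifts_iff_coeff_lifts] at hlift ⊢
    intro n
    obtain ⟨y, hy⟩ := hlift n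
    obtain ⟨b, hb⟩ := (IsGalois.mem_range_algebraMap_iff_fixed (F := K)
      ((MulSemiringAction.charpoly (L ≃ₐ[K] L) x).coeff n)).2
      (fun g => MulSemiringAction.smul_coeff_charpoly x n g)
    have h1 : b ∈ O.comap (algebraMap K L) := by
      rw [ValuationSubring.mem_comap, hb, ← hy]
      exact y.2
    rw [hO, ← hO', ValuationSubring.mem_comap] at h1
    exact ⟨⟨_, h1⟩, hb⟩
  obtain ⟨P, hP1, -, hP2⟩ := Polynomial.lifts_and_degree_eq_and_monic hlift'
    (MulSemiringAction.monic_charpoly _ x)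
  have hint : IsIntegral O' x := by
    refine ⟨P, hP2, ?_⟩
    rw [← Polynomial.eval_map]
    have : P.map (algebraMap O' L) = MulSemiringAction.charpoly (L ≃ₐ[K] L) x := hP1
    rw [this, MulSemiringAction.eval_charpoly]
  obtain ⟨z, hz⟩ := IsIntegrallyClosed.isIntegral_iff.1 hint
  rw [← hz]
  exact z.2

lemma aux_exists (v : Valuation K Γ) :
    ∃ O : ValuationSubring L, O.comap (algebraMap K L) = v.valuationSubring := by
  obtain ⟨O, h, hloc⟩ := IsLocalRing.exists_factor_valuationRing
    ((algebraMap K L).comp v.valuationSubring.subtype)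
  refine ⟨O, ?_⟩
  ext x
  rw [ValuationSubring.mem_comap]
  constructor
  · intro hx
    by_contra hnx
    have hx' : x⁻¹ ∈ v.valuationSubring :=
      (v.valuationSubring.mem_or_inv_mem x).resolve_left hnx
    have hx0 : x ≠ 0 := by
      rintro rfl
      exact hnx (zero_mem _)
    have hu : IsUnit (⟨x⁻¹, hx'⟩ : v.valuationSubring) := by
      apply hloc.map_nonunit
      refine IsUnit.of_mul_eq_one (⟨algebraMap K L x, hx⟩ : O.toSubring) ?_
      apply Subtype.ext
      show algebraMap K L x⁻¹ * algebraMap K L x = 1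
      rw [← map_mul, inv_mul_cancel₀ hx0, map_one]
    obtain ⟨u, hu⟩ := hu.exists_right_inv
    have h2 : x⁻¹ * (u : K) = 1 := congrArg Subtype.val hu
    have h3 : (u : K) = x := by
      field_simp at h2
      exact h2
    exact hnx (h3 ▸ u.2)
  · intro hx
    exact h ⟨x, hx⟩

end Main

theorem artinSchreier_closed_maximal_ideal_implies_phenselian
    (p : ℕ) (hp : p.Prime) (K : Type) [Field K] [CharP K p]
    {Γ : Type} [LinearOrderedCommGroupWithZero Γ] (v : Valuation K Γ)
    (hM : ∀ b : K, v b < 1 → ∃ x : K, x ^ p - x = b) :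
    IsPHenselian p K v := by
  intro L _ _ hfd hgal hfin
  obtain ⟨O, hO⟩ := aux_exists (L := L) v
  refine ⟨O, hO, fun O' hO' => ?_⟩
  exact le_antisymm
    (aux_le v O' O hO' hO (aux_stable hp v hM hfin O' hO'))
    (aux_le v O O' hO hO' (aux_stable hp v hM hfin O hO))
end

section
/- Let (K,v) be a valued field of characteristic p > 0. Then (K,v) is p-henselian if and only if M_v ⊆ {x^p - x : x ∈ K}. -/
namespace PH
section val
variable {L : Type*} [Field L] {Γ : Type*} [LinearOrderedCommGroupWithZero Γ]

lemma eq_one_of_sub_one_lt (w : Valuation L Γ) {a : L} (h : w (a - 1) < 1) : w a = 1 := by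
  have := w.map_one_add_of_lt h
  simpa using this

lemma mul_sub_one_lt (w : Valuation L Γ) {a b : L} (ha : w (a - 1) < 1) (hb : w (b - 1) < 1) :
    w (a * b - 1) < 1 := by
  have : a * b - 1 = a * (b - 1) + (a - 1) := by ring
  rw [this]
  refine w.map_add_lt ?_ ha
  rw [map_mul, eq_one_of_sub_one_lt w ha, one_mul]; exact hb

lemma pow_sub_one_lt (w : Valuation L Γ) {a : L} (ha : w (a - 1) < 1) (k : ℕ) :
    w (a ^ k - 1) < 1 := by
  induction k with
  | zero => simp
  | succ k ih => rw [pow_succ]; exact mul_sub_one_lt w ih ha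

lemma prod_sub_one_lt {ι : Type*} (w : Valuation L Γ) (s : Finset ι) (f : ι → L)
    (h : ∀ i ∈ s, w (f i - 1) < 1) : w ((∏ i ∈ s, f i) - 1) < 1 := by
  classical
  induction s using Finset.induction_on with
  | empty => simp
  | insert a s ha ih =>
    rw [Finset.prod_insert ha]
    exact mul_sub_one_lt w (h _ (by simp)) (ih fun i hi => h i (by simp [hi]))

lemma geom_lt (w : Valuation L Γ) {z : L} (hz : w z < 1) (n : ℕ) :
    w ((∑ i ∈ Finset.range (n + 1), z ^ i) - 1) < 1 := by
  rw [Finset.sum_range_succ']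
  simp only [pow_zero, add_sub_cancel_right]
  refine w.map_sum_lt one_ne_zero fun i _ => ?_
  rw [map_pow]
  exact pow_lt_one₀ zero_le hz (by simp)

lemma geom_gt (w : Valuation L Γ) {z : L} (hz : 1 < w z) (n : ℕ) (hn : 0 < n) :
    1 < w (∑ i ∈ Finset.range (n + 1), z ^ i) := by
  rw [Finset.sum_range_succ, add_comm, w.map_add_eq_of_lt_left]
  · rw [map_pow]; exact one_lt_pow₀ hz hn.ne'
  · refine w.map_sum_lt ?_ fun i hi => ?_
    · rw [map_pow]; exact pow_ne_zero _ (zero_lt_one.trans hz).ne'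
    · rw [map_pow, map_pow]
      exact pow_lt_pow_right₀ hz (Finset.mem_range.1 hi)

lemma geom_eq (p : ℕ) (hp : p.Prime) [CharP L p] (w : Valuation L Γ) {z : L} (hz : w z = 1) :
    ∃ N : ℕ, 0 < N ∧ ∀ m : ℕ, 1 ≤ w (∑ i ∈ Finset.range (N * m + 1), z ^ i) := by
  have hz1 : w (z - 1) ≤ 1 := w.map_sub_le hz.le (by simp)
  by_cases hd : ∃ d : ℕ, 0 < d ∧ w (z ^ d - 1) < 1
  · obtain ⟨d, hd0, hd⟩ := hd
    refine ⟨p * d, Nat.mul_pos hp.pos hd0, fun m => ?_⟩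
    by_cases h1 : w (z - 1) < 1
    · refine (eq_one_of_sub_one_lt w ?_).ge
      have : (∑ i ∈ Finset.range (p * d * m + 1), z ^ i) - 1
          = ∑ i ∈ Finset.range (p * d * m + 1), (z ^ i - 1) := by
        rw [Finset.sum_sub_distrib]; simp
      rw [this]
      exact w.map_sum_lt one_ne_zero fun i _ => pow_sub_one_lt w h1 i
    · have h1 : w (z - 1) = 1 := le_antisymm hz1 (not_lt.1 h1)
      have h2 := geom_sum_mul z (p * d * m + 1)
      have h3 : z ^ (p * d * m + 1) - 1 = (z - 1) + z * ((z ^ d) ^ (p * m) - 1) := by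
        rw [← pow_mul]; ring
      have h4 : w ((z - 1) + z * ((z ^ d) ^ (p * m) - 1)) = w (z - 1) := by
        apply w.map_add_eq_of_lt_left
        rw [map_mul, hz, one_mul, h1]
        exact pow_sub_one_lt w hd _
      have h5 := congrArg w h2
      rw [h3, h4, map_mul, h1, mul_one] at h5
      exact h5.ge
  · push Not at hd
    refine ⟨1, one_pos, fun m => ?_⟩
    have h2 := congrArg w (geom_sum_mul z (1 * m + 1))
    rw [map_mul] at h2
    have h3 := hd (1 * m + 1) (by omega)
    rw [← h2] at h3
    exact h3.trans (mul_le_of_le_one_right' hz1)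

lemma geom_ge (p : ℕ) (hp : p.Prime) [CharP L p] (w : Valuation L Γ) (z : L) :
    ∃ N : ℕ, 0 < N ∧ ∀ m : ℕ, 1 ≤ w (∑ i ∈ Finset.range (N * m + 1), z ^ i) := by
  rcases lt_trichotomy (w z) 1 with h | h | h
  · exact ⟨1, one_pos, fun m => (eq_one_of_sub_one_lt w (geom_lt w h _)).ge⟩
  · exact geom_eq p hp w h
  · refine ⟨1, one_pos, fun m => ?_⟩
    rcases Nat.eq_zero_or_pos m with rfl | hm
    · simp
    · exact (geom_gt w h _ (by omega)).le

lemma exists_sep (p : ℕ) (hp : p.Prime) [CharP L p] {ι : Type*} [Fintype ι]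
    (w : ι → Valuation L Γ) (z : L) :
    ∃ u : L, ∀ i, w i u ≤ 1 ∧ (w i z < 1 → w i (u - 1) < 1) ∧ (1 < w i z → w i u < 1) := by
  classical
  choose N hN0 hN using fun i => geom_ge p hp (w i) z
  set M := ∏ i, N i with hM
  have hM0 : 0 < M := Finset.prod_pos fun i _ => hN0 i
  refine ⟨(∑ i ∈ Finset.range (M + 1), z ^ i)⁻¹, fun i => ⟨?_, fun h => ?_, fun h => ?_⟩⟩
  · obtain ⟨m, hm⟩ := Finset.dvd_prod_of_mem N (Finset.mem_univ i)
    rw [map_inv₀, hM, hm]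
    exact inv_le_one_of_one_le₀ (hN i m)
  · have h1 := geom_lt (w i) h M
    have h2 := eq_one_of_sub_one_lt _ h1
    set s := ∑ i ∈ Finset.range (M + 1), z ^ i
    have hs : s ≠ 0 := by
      intro h; rw [h] at h2; simp at h2
    have : s⁻¹ - 1 = s⁻¹ * -(s - 1) := by field_simp; ring
    rw [this, map_mul, map_inv₀, h2, Valuation.map_neg]
    simpa using h1
  · rw [map_inv₀]
    exact inv_lt_one_of_one_lt₀ (geom_gt (w i) h M hM0)

lemma lt_one_iff_inv (w : Valuation L Γ) (x : L) : w x < 1 ↔ x = 0 ∨ ¬ w x⁻¹ ≤ 1 := by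
  by_cases hx : x = 0
  · simp [hx]
  · have : 0 < w x := zero_lt_iff.2 (w.ne_zero_iff.2 hx)
    simp [hx, one_lt_inv₀ this]

lemma pow_sub_self (p : ℕ) (hp : p.Prime) [CharP L p] {x : L} (h : x ^ p = x) :
    ∃ n : ℤ, (n : L) = x := by
  have := Fact.mk hp
  exact (mem_bot_iff_intCast p L).1 ((Subfield.mem_bot_iff_pow_eq_self L p).2 h)

lemma intCast_pow (p : ℕ) (hp : p.Prime) [CharP L p] (n : ℤ) : (n : L) ^ p = n := by
  have := Fact.mk hp
  exact (Subfield.mem_bot_iff_pow_eq_self L p).1 ((mem_bot_iff_intCast p L).2 ⟨n, rfl⟩)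

lemma intCast_le (w : Valuation L Γ) (n : ℤ) : w (n : L) ≤ 1 := by
  have : (n : L) ∈ w.valuationSubring := intCast_mem _ n
  exact this

open Polynomial in
lemma exists_int_lt (p : ℕ) (hp : p.Prime) [CharP L p] (w : Valuation L Γ) (x : L)
    (h : w (x ^ p - x) < 1) : ∃ n : ℤ, w (x - n) < 1 := by
  have := Fact.mk hp
  by_contra! hc
  have h1 : (X ^ p - X : (ZMod p)[X]) = ∏ i : ZMod p, (X - C i) := by
    have h2 : (X ^ p - X : (ZMod p)[X]).Monic := by
      apply monic_X_pow_sub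
      rw [degree_X]; exact_mod_cast hp.one_lt
    have h3 := (FiniteField.splits_X_pow_card_sub_X (K := ZMod p) p)
    have h4 := FiniteField.roots_X_pow_card_sub_X (ZMod p)
    simp only [ZMod.card, Algebra.algebraMap_self, Polynomial.map_id] at h3 h4
    have h5 := h3.eq_prod_roots_of_monic h2
    rw [h4] at h5
    exact h5
  have h2 := congrArg (Polynomial.eval₂ (ZMod.castHom dvd_rfl L) x) h1
  rw [Polynomial.eval₂_finsetProd] at h2
  simp only [eval₂_sub, eval₂_pow, eval₂_X, eval₂_C] at h2
  rw [h2, map_prod] at h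
  refine absurd h (not_lt.2 ?_)
  refine Finset.one_le_prod' fun i _ => ?_
  obtain ⟨n, rfl⟩ := ZMod.intCast_surjective i
  simpa using hc n

end val

section bwd
variable {K L : Type*} [Field K] [Field L] [Algebra K L] [FiniteDimensional K L] [IsGalois K L]
  {Γ Γ' : Type*} [LinearOrderedCommGroupWithZero Γ] [LinearOrderedCommGroupWithZero Γ']

lemma no_incomparable (p : ℕ) (hp : p.Prime) [CharP K p] (hfin : Module.finrank K L = p)
    (v : Valuation K Γ) (w : Valuation L Γ') (hvw : ∀ x, w (algebraMap K L x) ≤ 1 ↔ v x ≤ 1)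
    (hv : ∀ b, v b < 1 → ∃ x, x ^ p - x = b)
    (hinc : ∀ g : L ≃ₐ[K] L, g ≠ 1 → ∃ x, w x ≤ 1 ∧ 1 < w (g x)) : False := by
  classical
  have := Fact.mk hp
  have : CharP L p := charP_of_injective_algebraMap (algebraMap K L).injective p
  have hcard : Nat.card (L ≃ₐ[K] L) = p := by rw [IsGalois.card_aut_eq_finrank, hfin]
  have hz : ∀ g : L ≃ₐ[K] L, g ≠ 1 → ∃ z, w z < 1 ∧ 1 < w (g z) := by
    intro g hg
    obtain ⟨x, hx, hgx⟩ := hinc g hg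
    obtain ⟨t, ht, hgt⟩ := hinc g⁻¹ (by simpa using hg)
    have ht0 : t ≠ 0 := by rintro rfl; simp at hgt
    have hgg : g (g⁻¹ t) = t := by
      rw [← AlgEquiv.mul_apply, mul_inv_cancel]; rfl
    refine ⟨x / g⁻¹ t, ?_, ?_⟩
    · rw [map_div₀]
      exact (div_lt_one₀ (zero_lt_one.trans hgt)).2 (hx.trans_lt hgt)
    · rw [map_div₀, map_div₀, hgg]
      exact (one_lt_div₀ (zero_lt_iff.2 (w.ne_zero_iff.2 ht0))).2 (ht.trans_lt hgx)
  have hu : ∀ g : L ≃ₐ[K] L, ∃ u, g ≠ 1 → (w (u - 1) < 1 ∧ w (g u) < 1 ∧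
      ∀ h : L ≃ₐ[K] L, w (h u) ≤ 1) := by
    intro g
    by_cases hg : g = 1
    · exact ⟨0, fun h => absurd hg h⟩
    obtain ⟨z, hz1, hz2⟩ := hz g hg
    obtain ⟨u, hu⟩ := exists_sep p hp (fun h : L ≃ₐ[K] L => w.comap (h : L →+* L)) z
    exact ⟨u, fun _ => ⟨(hu 1).2.1 hz1, (hu g).2.2 hz2, fun h => (hu h).1⟩⟩
  choose u hu using hu
  obtain ⟨θ, hθ1, hθ⟩ : ∃ θ : L, w (θ - 1) < 1 ∧ ∀ g : L ≃ₐ[K] L, g ≠ 1 → w (g θ) < 1 := by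
    refine ⟨∏ g ∈ Finset.univ.erase 1, u g, ?_, fun h hh => ?_⟩
    · exact prod_sub_one_lt _ _ _ fun g hg => (hu g (Finset.ne_of_mem_erase hg)).1
    · rw [map_prod, map_prod, ← Finset.mul_prod_erase _ _ (a := h) (by simp [hh])]
      refine (mul_le_of_le_one_right' (Finset.prod_le_one' fun g hg => ?_)).trans_lt (hu h hh).2.1
      refine (hu g ?_).2.2 h
      exact Finset.ne_of_mem_erase (Finset.mem_of_mem_erase hg)
  -- normalise the trace
  set t := Algebra.trace K L θ with ht
  have htr : algebraMap K L t = ∑ g : L ≃ₐ[K] L, g θ := trace_eq_sum_automorphisms θ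
  have ht1 : w (algebraMap K L t - 1) < 1 := by
    rw [htr, ← Finset.add_sum_erase _ _ (Finset.mem_univ 1), AlgEquiv.one_apply, add_sub_right_comm]
    exact w.map_add_lt hθ1 (w.map_sum_lt one_ne_zero fun g hg => hθ g (Finset.ne_of_mem_erase hg))
  have ht2 := eq_one_of_sub_one_lt w ht1
  have ht0 : algebraMap K L t ≠ 0 := by intro h; rw [h] at ht2; simp at ht2
  obtain ⟨e⟩ : Nonempty ((L ≃ₐ[K] L) ≃* Multiplicative (ZMod p)) :=
    ⟨mulEquivOfPrimeCardEq hcard (by simp)⟩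
  let φ := ZMod.castHom (dvd_refl p) L
  let χ : (L ≃ₐ[K] L) → L := fun g => φ (e g).toAdd
  have hχint : ∀ g, ∃ n : ℤ, (n : L) = χ g := fun g => by
    obtain ⟨n, hn⟩ := ZMod.intCast_surjective (e g).toAdd
    exact ⟨n, by simp only [χ]; rw [← hn]; simp⟩
  have hχfix : ∀ g h : L ≃ₐ[K] L, g (χ h) = χ h := fun g h => by
    obtain ⟨n, hn⟩ := hχint h
    rw [← hn]; simp
  have hχmul : ∀ g h, χ (g * h) = χ g + χ h := fun g h => by simp [χ]
  have hχ1 : χ 1 = 0 := by simp [χ]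
  set α : L := ∑ g : L ≃ₐ[K] L, χ g * (g θ / algebraMap K L t) with hα
  have hαlt : w α < 1 := by
    refine w.map_sum_lt one_ne_zero fun g _ => ?_
    by_cases hg : g = 1
    · simp [hg, hχ1]
    · rw [map_mul, map_div₀, ht2, div_one]
      obtain ⟨n, hn⟩ := hχint g
      rw [← hn]
      exact (mul_le_of_le_one_left' (intCast_le w n)).trans_lt (hθ g hg)
  have hτ : ∀ τ : L ≃ₐ[K] L, τ α = α - χ τ := by
    intro τ
    have h1 : τ α = ∑ g : L ≃ₐ[K] L, (χ (τ * g) - χ τ) * ((τ * g) θ / algebraMap K L t) := by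
      rw [hα, map_sum]
      refine Finset.sum_congr rfl fun g _ => ?_
      rw [map_mul, map_div₀, hχfix, hχmul]
      simp
    rw [h1, (Group.mulLeft_bijective τ).sum_comp
      (fun g : L ≃ₐ[K] L => (χ g - χ τ) * (g θ / algebraMap K L t))]
    simp only [sub_mul, Finset.sum_sub_distrib]
    rw [← Finset.mul_sum, ← Finset.sum_div, ← htr, div_self ht0, mul_one]
  have hpow : ∀ g, χ g ^ p = χ g := fun g => by
    obtain ⟨n, hn⟩ := hχint g
    rw [← hn]; exact intCast_pow p hp n
  obtain ⟨b, hb⟩ : α ^ p - α ∈ Set.range (algebraMap K L) := by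
    rw [IsGalois.mem_range_algebraMap_iff_fixed]
    intro τ
    rw [map_sub, map_pow, hτ, sub_pow_char, hpow]
    ring
  have hwb : w (algebraMap K L b) < 1 := by
    rw [hb]
    refine w.map_sub_lt ?_ hαlt
    rw [map_pow]; exact pow_lt_one₀ zero_le hαlt hp.ne_zero
  have hvb : v b < 1 := by
    rw [lt_one_iff_inv] at hwb ⊢
    rwa [← map_inv₀, hvw, map_eq_zero] at hwb
  obtain ⟨x, hx⟩ := hv b hvb
  have h3 : (α - algebraMap K L x) ^ p = α - algebraMap K L x := by
    rw [sub_pow_char, ← map_pow, ← sub_eq_zero]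
    have : algebraMap K L (x ^ p - x) = α ^ p - α := by rw [hx, hb]
    rw [map_sub] at this
    linear_combination -this
  obtain ⟨n, hn⟩ := pow_sub_self p hp h3
  have h4 : α = algebraMap K L (x + n) := by
    rw [map_add, map_intCast, hn]; ring
  have h5 : ∀ τ, χ τ = 0 := fun τ => by
    have := hτ τ
    rw [h4, AlgEquiv.commutes] at this
    linear_combination this
  have h6 : ∀ τ : L ≃ₐ[K] L, τ = 1 := fun τ => by
    have h7 : (e τ).toAdd = 0 := by
      have := h5 τ
      simp only [χ] at this
      exact (map_eq_zero φ).1 this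
    exact e.injective (by rw [map_one]; exact h7)
  have : Subsingleton (L ≃ₐ[K] L) := ⟨fun a b => by rw [h6 a, h6 b]⟩
  have := Nat.card_of_subsingleton (1 : L ≃ₐ[K] L)
  exact hp.one_lt.ne' (hcard.symm.trans this)

lemma invariant (p : ℕ) (hp : p.Prime) [CharP K p] (hfin : Module.finrank K L = p)
    (v : Valuation K Γ) (w : Valuation L Γ') (hvw : ∀ x, w (algebraMap K L x) ≤ 1 ↔ v x ≤ 1)
    (hv : ∀ b, v b < 1 → ∃ x, x ^ p - x = b) (h : L ≃ₐ[K] L) (x : L) (hx : w x ≤ 1) :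
    w (h x) ≤ 1 := by
  have := Fact.mk hp
  have hcard : Nat.card (L ≃ₐ[K] L) = p := by rw [IsGalois.card_aut_eq_finrank, hfin]
  obtain ⟨g, hg, hgx⟩ : ∃ g : L ≃ₐ[K] L, g ≠ 1 ∧ ∀ x, w x ≤ 1 → w (g x) ≤ 1 := by
    by_contra! hc
    exact no_incomparable p hp hfin v w hvw hv hc
  obtain ⟨k, rfl⟩ := mem_powers_of_prime_card hcard hg (g' := h)
  have : ∀ k : ℕ, w ((g ^ k) x) ≤ 1 := fun k => by
    induction k with
    | zero => simpa using hx
    | succ k ih => rw [pow_succ']; exact hgx _ ih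
  exact this k

lemma le_of_ext {Γ'' : Type*} [LinearOrderedCommGroupWithZero Γ'']
    (p : ℕ) (hp : p.Prime) [CharP K p] (hfin : Module.finrank K L = p)
    (v : Valuation K Γ) (w : Valuation L Γ') (hvw : ∀ x, w (algebraMap K L x) ≤ 1 ↔ v x ≤ 1)
    (w' : Valuation L Γ'') (hvw' : ∀ x, w' (algebraMap K L x) ≤ 1 ↔ v x ≤ 1)
    (hv : ∀ b, v b < 1 → ∃ x, x ^ p - x = b) (x : L) (hx : w x ≤ 1) : w' x ≤ 1 := by
  classical
  by_contra hc
  have h1 : ∀ g : L ≃ₐ[K] L, 1 < w' (g x) := fun g => by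
    by_contra! h
    have := invariant p hp hfin v w' hvw' hv g⁻¹ _ h
    rw [← AlgEquiv.mul_apply, inv_mul_cancel] at this
    exact hc this
  have h2 := Algebra.norm_eq_prod_automorphisms K x
  have h3 : w (algebraMap K L (Algebra.norm K x)) ≤ 1 := by
    rw [h2, map_prod]
    exact Finset.prod_le_one' fun g _ => invariant p hp hfin v w hvw hv g x hx
  rw [hvw, ← hvw', h2, map_prod, ← Finset.mul_prod_erase _ _ (Finset.mem_univ 1)] at h3
  refine absurd h3 (not_le.2 ?_)
  exact one_lt_mul_of_lt_of_le' (h1 1) (Finset.one_le_prod' fun g _ => (h1 g).le)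

end bwd

lemma exists_ext {K L : Type*} [Field K] [Field L] [Algebra K L] (A : ValuationSubring K) :
    ∃ O : ValuationSubring L, O.comap (algebraMap K L) = A := by
  obtain ⟨O, h, hO⟩ := IsLocalRing.exists_factor_valuationRing ((algebraMap K L).comp A.subtype)
  refine ⟨O, ?_⟩
  ext x
  rw [ValuationSubring.mem_comap]
  refine ⟨fun hx => ?_, fun hx => h ⟨x, hx⟩⟩
  by_contra hxA
  have hinv : x⁻¹ ∈ A := (A.mem_or_inv_mem x).resolve_left hxA
  have hx0 : x ≠ 0 := by rintro rfl; exact hxA A.zero_mem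
  have hu : IsUnit (⟨x⁻¹, hinv⟩ : A) := by
    apply hO.map_nonunit
    refine IsUnit.of_mul_eq_one (⟨algebraMap K L x, hx⟩ : O.toSubring) ?_
    apply Subtype.ext
    change algebraMap K L x⁻¹ * algebraMap K L x = 1
    rw [← map_mul, inv_mul_cancel₀ hx0, map_one]
  obtain ⟨y, hy⟩ := hu.exists_right_inv
  have hy' : x⁻¹ * (y : K) = 1 := congrArg Subtype.val hy
  have : (y : K) = x := by
    field_simp at hy'; exact hy'
  exact hxA (this ▸ y.2)

section fwd
open Polynomial
variable {K L : Type*} [Field K] [Field L] [Algebra K L]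

lemma galois_artin (p : ℕ) (hp : p.Prime) [CharP K p] (b : K) (hb : ¬ ∃ x : K, x ^ p - x = b)
    [IsSplittingField K L (X ^ p - X - C b)] :
    FiniteDimensional K L ∧ IsGalois K L ∧ Module.finrank K L = p ∧
      ∃ α : L, α ^ p - α = algebraMap K L b ∧ ∃ σ : L ≃ₐ[K] L, σ α ≠ α := by
  have := Fact.mk hp
  have : CharP L p := charP_of_injective_algebraMap (algebraMap K L).injective p
  have hdeg : (X ^ p - X - C b : K[X]).natDegree = p := by
    rw [natDegree_sub_C, FiniteField.X_pow_card_sub_X_natDegree_eq _ hp.one_lt]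
  have hsep : (X ^ p - X - C b : K[X]).Separable := by
    refine ⟨0, -1, ?_⟩
    simp [derivative_X_pow]
  have hfd : FiniteDimensional K L := IsSplittingField.finiteDimensional L (X ^ p - X - C b)
  have hgal : IsGalois K L := IsGalois.of_separable_splitting_field hsep
  obtain ⟨α, hα⟩ : ∃ α : L, α ^ p - α = algebraMap K L b := by
    have h1 := IsSplittingField.splits L (X ^ p - X - C b : K[X])
    obtain ⟨α, hα⟩ := h1.exists_eval_eq_zero (by
      rw [degree_map]; intro h; rw [natDegree_eq_of_degree_eq_some h] at hdeg
      exact hp.ne_zero hdeg.symm)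
    refine ⟨α, ?_⟩
    simpa [sub_eq_zero] using hα
  have hroot : ∀ β : L, β ^ p - β = algebraMap K L b → ∃ n : ℤ, β = α + n := fun β hβ => by
    obtain ⟨n, hn⟩ := pow_sub_self p hp (x := β - α) (by
      rw [sub_pow_char]; linear_combination hβ - hα)
    exact ⟨n, by rw [hn]; ring⟩
  have hgα : ∀ g : L ≃ₐ[K] L, ∃ n : ℤ, g α = α + n := fun g => hroot _ (by
    rw [← map_pow, ← map_sub, hα, AlgEquiv.commutes])
  have hext : ∀ g : L ≃ₐ[K] L, g α = α → g = 1 := fun g hg => by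
    have h1 := IsSplittingField.adjoin_rootSet L (X ^ p - X - C b : K[X])
    have h2 : (g : L →ₐ[K] L) = AlgHom.id K L := by
      refine AlgHom.ext_of_adjoin_eq_top h1 fun β hβ => ?_
      rw [mem_rootSet] at hβ
      obtain ⟨n, rfl⟩ := hroot β (by simpa [sub_eq_zero] using hβ.2)
      simp [hg]
    ext x
    exact DFunLike.congr_fun h2 x
  obtain ⟨σ, hσ⟩ : ∃ σ : L ≃ₐ[K] L, σ α ≠ α := by
    by_contra! hc
    obtain ⟨a, ha⟩ := (IsGalois.mem_range_algebraMap_iff_fixed (F := K) α).2 hc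
    refine hb ⟨a, (algebraMap K L).injective ?_⟩
    rw [← hα, ← ha]; simp
  refine ⟨hfd, hgal, ?_, α, hα, σ, hσ⟩
  -- cardinality
  choose c hc using hgα
  let ψ : (L ≃ₐ[K] L) →* Multiplicative (ZMod p) := MonoidHom.mk' (fun g => .ofAdd (c g : ZMod p))
    (fun g h => by
      rw [← ofAdd_add]
      congr 1
      rw [← Int.cast_add, ZMod.intCast_eq_intCast_iff_dvd_sub, ← CharP.intCast_eq_zero_iff L p]
      have h1 := hc (g * h)
      rw [AlgEquiv.mul_apply, hc h, map_add, hc g, map_intCast] at h1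
      push_cast
      linear_combination h1)
  have hψ : Function.Injective ψ := by
    rw [injective_iff_map_eq_one]
    intro g hg
    apply hext
    rw [hc]
    have : (c g : ZMod p) = 0 := hg
    rw [ZMod.intCast_zmod_eq_zero_iff_dvd, ← CharP.intCast_eq_zero_iff L p] at this
    rw [this, add_zero]
  have hdvd := Subgroup.card_dvd_of_injective ψ hψ
  rw [IsGalois.card_aut_eq_finrank] at hdvd
  simp only [Nat.card_eq_fintype_card, Fintype.card_multiplicative, ZMod.card] at hdvd
  refine ((Nat.dvd_prime hp).1 hdvd).resolve_left fun h1 => ?_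
  rw [← IsGalois.card_aut_eq_finrank, Nat.card_eq_one_iff_unique] at h1
  have := h1.1
  exact hσ (by rw [Subsingleton.elim σ 1]; rfl)

end fwd
end PH

theorem phenselian_iff_artinSchreier_closed_maximal_ideal
    (p : ℕ) (hp : p.Prime) (K : Type) [Field K] [CharP K p]
    {Γ : Type} [LinearOrderedCommGroupWithZero Γ] (v : Valuation K Γ) :
    IsPHenselian p K v ↔ {b : K | v b < 1} ⊆ {b : K | ∃ x : K, x ^ p - x = b} := by
  constructor
  · intro H b hb
    by_contra hx
    let f : Polynomial K := Polynomial.X ^ p - Polynomial.X - Polynomial.C b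
    obtain ⟨hfd, hgal, hrk, α, hα, σ, hσ⟩ :=
      PH.galois_artin (L := f.SplittingField) p hp b hx
    have : CharP f.SplittingField p :=
      charP_of_injective_algebraMap (algebraMap K f.SplittingField).injective p
    obtain ⟨O, hO, huniq⟩ := H f.SplittingField hfd hgal hrk
    have hinv : O.comap (σ : f.SplittingField →+* f.SplittingField) = O := by
      apply huniq
      change (O.comap (σ : f.SplittingField →+* f.SplittingField)).comap _ = _
      rw [ValuationSubring.comap_comap, ← hO]
      congr 1
      ext x
      simp
    have hmem : ∀ x, O.valuation x < 1 → O.valuation (σ x) < 1 := by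
      intro x h
      rw [PH.lt_one_iff_inv] at h ⊢
      rw [ValuationSubring.valuation_le_one_iff] at h ⊢
      refine h.imp (fun h => by rw [h, map_zero]) (fun h h' => h ?_)
      rw [← hinv, ValuationSubring.mem_comap]
      simpa using h'
    have hbO : O.valuation (algebraMap K _ b) < 1 := by
      have hb : v b < 1 := hb
      rw [PH.lt_one_iff_inv] at hb ⊢
      refine hb.imp (fun h => by rw [h, map_zero]) (fun h h' => h ?_)
      rw [ValuationSubring.valuation_le_one_iff, ← map_inv₀, ← ValuationSubring.mem_comap, hO] at h'
      exact h'
    rw [← hα] at hbO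
    obtain ⟨n, hn⟩ := PH.exists_int_lt p hp _ _ hbO
    have h2 := hmem _ hn
    have h3 : O.valuation (σ α - α) < 1 := by
      have : σ α - α = σ (α - n) - (α - n) := by simp
      rw [this]
      exact O.valuation.map_sub_lt h2 hn
    obtain ⟨m, hm⟩ := PH.pow_sub_self p hp (x := σ α - α) (by
      have := Fact.mk hp
      have h4 : σ (α ^ p - α) = α ^ p - α := by rw [hα, AlgEquiv.commutes]
      rw [map_sub, map_pow] at h4
      rw [sub_pow_char]; linear_combination h4)
    have h0 : σ α - α ≠ 0 := sub_ne_zero.2 hσ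
    have h5 : (σ α - α) ^ (p - 1) = 1 := by
      have := PH.intCast_pow (L := f.SplittingField) p hp m
      rw [hm] at this
      apply mul_right_cancel₀ h0
      rw [← pow_succ, Nat.sub_add_cancel hp.one_le, this, one_mul]
    have h6 : O.valuation ((σ α - α) ^ (p - 1)) < 1 := by
      rw [map_pow]
      exact pow_lt_one₀ zero_le h3 (by have := hp.one_lt; omega)
    rw [h5, map_one] at h6
    exact lt_irrefl _ h6
  · intro H L _ _ hfd hgal hrk
    obtain ⟨O, hO⟩ := PH.exists_ext (L := L) v.valuationSubring
    have key : ∀ O : ValuationSubring L, O.comap (algebraMap K L) = v.valuationSubring →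
        ∀ x, O.valuation (algebraMap K L x) ≤ 1 ↔ v x ≤ 1 := fun O hO x => by
      rw [ValuationSubring.valuation_le_one_iff, ← ValuationSubring.mem_comap, hO]; rfl
    have hle : ∀ O O' : ValuationSubring L, O.comap (algebraMap K L) = v.valuationSubring →
        O'.comap (algebraMap K L) = v.valuationSubring → O ≤ O' := fun O O' hO hO' x hx => by
      rw [← ValuationSubring.valuation_le_one_iff] at hx ⊢
      exact PH.le_of_ext p hp hrk v O.valuation (key O hO) O'.valuation (key O' hO')
        (fun b hb => H hb) x hx
    exact ⟨O, hO, fun O' hO' => le_antisymm (hle _ _ hO' hO) (hle _ _ hO hO')⟩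
end
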